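/- Let γ > 0. For all nonnegative measurable functions f, g on a σ-finite measure space with ⟨f^{1+γ}⟩ < ∞ and ⟨g^{1+γ}⟩ < ∞, the density power divergence is nonnegative: ⟨g^{1+γ}⟩ - ((1+γ)/γ)·⟨f g^γ⟩ + (1/γ)·⟨f^{1+γ}⟩ ≥ 0. Moreover, if p and q are probability densities with ⟨p^{1+γ}⟩ < ∞ and ⟨q^{1+γ}⟩ < ∞ and equality holds, then p = q almost everywhere. -/

import Mathlib

open MeasureTheory

/-- The strict form of Young's inequality `(1 + γ) a b ^ γ ≤ a ^ (1 + γ) + γ b ^ (1 + γ)`. -/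
theorem one_add_mul_mul_rpow_lt {γ a b : ℝ} (hγ : 0 < γ) (ha : 0 ≤ a) (hb : 0 ≤ b)
    (hab : a ≠ b) :
    (1 + γ) * (a * b ^ γ) < a ^ (1 + γ) + γ * b ^ (1 + γ) := by
  rcases hb.eq_or_lt with rfl | hb
  · rw [Real.zero_rpow hγ.ne', Real.zero_rpow (by positivity)]
    have := Real.rpow_pos_of_pos (ha.lt_of_ne' hab) (1 + γ)
    linarith
  · have hs : -1 ≤ a / b - 1 := by linarith [div_nonneg ha hb.le]
    have hs' : a / b - 1 ≠ 0 := by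
      rw [sub_ne_zero, Ne, div_eq_one_iff_eq hb.ne']
      exact hab
    have h := one_add_mul_self_lt_rpow_one_add hs hs' (by linarith : 1 < 1 + γ)
    rw [add_sub_cancel, Real.div_rpow ha hb.le, lt_div_iff₀ (by positivity)] at h
    have hpow : b ^ (1 + γ) = b * b ^ γ := by rw [Real.rpow_add hb, Real.rpow_one]
    have hexp : (1 + (1 + γ) * (a / b - 1)) * (b * b ^ γ)
        = (1 + γ) * (a * b ^ γ) - γ * (b * b ^ γ) := by
      field_simp
      ring
    rw [hpow] at h ⊢
    linarith

theorem one_add_mul_mul_rpow_self {γ a : ℝ} (hγ : 0 < γ) (ha : 0 ≤ a) :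
    (1 + γ) * (a * a ^ γ) = a ^ (1 + γ) + γ * a ^ (1 + γ) := by
  rw [Real.rpow_add_of_nonneg ha zero_le_one hγ.le, Real.rpow_one]
  ring

theorem one_add_mul_mul_rpow_le {γ a b : ℝ} (hγ : 0 < γ) (ha : 0 ≤ a) (hb : 0 ≤ b) :
    (1 + γ) * (a * b ^ γ) ≤ a ^ (1 + γ) + γ * b ^ (1 + γ) := by
  rcases eq_or_ne a b with rfl | hab
  · exact (one_add_mul_mul_rpow_self hγ ha).le
  · exact (one_add_mul_mul_rpow_lt hγ ha hb hab).le

/-- The density power divergence is nonnegative: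
`⟨g^(1+γ)⟩ - ((1+γ)/γ)⟨f g^γ⟩ + (1/γ)⟨f^(1+γ)⟩ ≥ 0` for nonnegative measurable `f, g`
with finite `L^(1+γ)` integrals; moreover if `f` and `g` are probability densities and
equality holds, then `f = g` almost everywhere. -/
theorem density_power_divergence_nonneg {Ω : Type*} [MeasurableSpace Ω] (m : Measure Ω)
    [SigmaFinite m] (γ : ℝ) (hγ : 0 < γ)
    (f g : Ω → ℝ) (hfm : Measurable f) (hgm : Measurable g)
    (hf0 : ∀ ω, 0 ≤ f ω) (hg0 : ∀ ω, 0 ≤ g ω)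
    (hfi : Integrable (fun ω => f ω ^ (1 + γ)) m)
    (hgi : Integrable (fun ω => g ω ^ (1 + γ)) m) :
    0 ≤ (∫ ω, g ω ^ (1 + γ) ∂m) - ((1 + γ) / γ) * (∫ ω, f ω * g ω ^ γ ∂m)
        + (1 / γ) * (∫ ω, f ω ^ (1 + γ) ∂m)
    ∧ ((∫ ω, f ω ∂m) = 1 → (∫ ω, g ω ∂m) = 1 →
        (∫ ω, g ω ^ (1 + γ) ∂m) - ((1 + γ) / γ) * (∫ ω, f ω * g ω ^ γ ∂m)
          + (1 / γ) * (∫ ω, f ω ^ (1 + γ) ∂m) = 0 →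
        f =ᵐ[m] g) := by
  have hfg : Integrable (fun ω => f ω * g ω ^ γ) m := by
    refine (hfi.add (hgi.const_mul γ)).mono' (by fun_prop) (.of_forall fun ω => ?_)
    have h0 : 0 ≤ f ω * g ω ^ γ := mul_nonneg (hf0 ω) (Real.rpow_nonneg (hg0 ω) γ)
    rw [Real.norm_of_nonneg h0]
    refine le_trans ?_ (one_add_mul_mul_rpow_le hγ (hf0 ω) (hg0 ω))
    exact le_mul_of_one_le_left h0 (by linarith)
  have hsum : Integrable (fun ω => f ω ^ (1 + γ) + γ * g ω ^ (1 + γ)) m :=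
    hfi.add (hgi.const_mul γ)
  let D : Ω → ℝ := fun ω => f ω ^ (1 + γ) + γ * g ω ^ (1 + γ) - (1 + γ) * (f ω * g ω ^ γ)
  have hD0 : 0 ≤ D := fun ω => sub_nonneg.2 (one_add_mul_mul_rpow_le hγ (hf0 ω) (hg0 ω))
  have hDi : Integrable D m := hsum.sub (hfg.const_mul (1 + γ))
  have hD : (∫ ω, g ω ^ (1 + γ) ∂m) - ((1 + γ) / γ) * (∫ ω, f ω * g ω ^ γ ∂m)
      + (1 / γ) * (∫ ω, f ω ^ (1 + γ) ∂m) = (∫ ω, D ω ∂m) / γ := by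
    simp only [D]
    rw [integral_sub hsum (hfg.const_mul (1 + γ)), integral_add hfi (hgi.const_mul γ),
      integral_const_mul, integral_const_mul]
    field_simp
    ring
  rw [hD]
  refine ⟨div_nonneg (integral_nonneg hD0) hγ.le, fun _ _ h => ?_⟩
  have hz : ∫ ω, D ω ∂m = 0 := (div_eq_zero_iff.1 h).resolve_right hγ.ne'
  filter_upwards [(integral_eq_zero_iff_of_nonneg hD0 hDi).1 hz] with ω hω
  by_contra hne
  exact (sub_pos.2 (one_add_mul_mul_rpow_lt hγ (hf0 ω) (hg0 ω) hne)).ne' hω
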